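/- The disjoint union of two graphs G₁ and G₂ (with at least one vertex each, and at least 3 vertices total) is ensnaring if and only if both G₁ and G₂ are ensnaring but not revolutionary. -/

import Mathlib

open scoped Classical

/-- The state space `Ξₙ` for a graph on vertex set `V` with `n = |V|`: a state `(v, i, ε)`
consists of a bijection `v` from the vertices to the positions `ℤ/n` (the replica of vertex
`a` sits at position `v a`; positions increase clockwise), the index `i : ℤ/n`, and the
orientation `ε ∈ {±1}` encoded as a `Bool` (`true` = `+1`, `false` = `-1`). -/
abbrev Xi (V : Type*) [Fintype V] : Type _ :=
  (V ≃ ZMod (Fintype.card V)) × ZMod (Fintype.card V) × Bool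

/-- The orientation `ε` as an element of `ℤ/n`. -/
def epsZ (n : ℕ) (e : Bool) : ZMod n := if e then 1 else -1

/-- Refractive toric promotion `Θ_G`:
`Θ_G (v,i,ε) = (s̄ᵢ v, i+ε, ε)` if `{v⁻¹(i), v⁻¹(i+1)}` is not an edge of `G`, and
`Θ_G (v,i,ε) = (s̄ᵢ v, i−ε, −ε)` if it is an edge of `G`.  Here `s̄ᵢ v` swaps the replicas
sitting at positions `i` and `i+1`. -/
noncomputable def theta {V : Type*} [Fintype V] (G : SimpleGraph V) (D : Xi V) : Xi V :=
  if G.Adj (D.1.symm D.2.1) (D.1.symm (D.2.1 + 1)) then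
    (D.1.trans (Equiv.swap D.2.1 (D.2.1 + 1)), D.2.1 - epsZ _ D.2.2, !D.2.2)
  else
    (D.1.trans (Equiv.swap D.2.1 (D.2.1 + 1)), D.2.1 + epsZ _ D.2.2, D.2.2)

/-- The net number of clockwise steps that the replica of vertex `a` makes during one
application of `Θ_G` to the state `D`: each application swaps the replicas at positions
`i` and `i+1`, moving the former one step clockwise and the latter one step
counterclockwise. -/
def disp {V : Type*} [Fintype V] (D : Xi V) (a : V) : ℤ :=
  if D.1 a = D.2.1 then 1 else if D.1 a = D.2.1 + 1 then -1 else 0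

/-- `n` times the winding number `w_O(a)` of vertex `a` with respect to the orbit `O` of the
state `D` under `Θ_G`: the net number of clockwise steps made by the replica of `a` during
`P` consecutive applications of `Θ_G` starting from `D`, where `P` is the size of the orbit
(i.e. the minimal period of `D`).  The winding number itself is `windSum G D a / n`; in
particular `w_O(a) = 0` iff `windSum G D a = 0`, and `w_O(a) = w_O(b)` iff
`windSum G D a = windSum G D b`. -/
noncomputable def windSum {V : Type*} [Fintype V] (G : SimpleGraph V) (D : Xi V) (a : V) : ℤ :=
  ∑ k ∈ Finset.range (Function.minimalPeriod (theta G) D), disp ((theta G)^[k] D) a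

/-- The winding vector of the orbit of `D` under `Θ_G` is zero. -/
def WindingVectorZero {V : Type*} [Fintype V] (G : SimpleGraph V) (D : Xi V) : Prop :=
  ∀ a : V, windSum G D a = 0

/-- `G` is ensnaring if every orbit of `Θ_G` has winding vector `0`.  By the convention of
the paper, a graph with exactly one vertex is ensnaring. -/
def Ensnaring {V : Type*} [Fintype V] (G : SimpleGraph V) : Prop :=
  Fintype.card V = 1 ∨ ∀ D : Xi V, WindingVectorZero G D

/-- The net number of clockwise steps the stone makes during one application of `Θ_G`:
the stone stays put when it refracts (edge present) and moves one step in direction `ε`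
otherwise. -/
noncomputable def stoneDisp {V : Type*} [Fintype V] (G : SimpleGraph V) (D : Xi V) : ℤ :=
  if G.Adj (D.1.symm D.2.1) (D.1.symm (D.2.1 + 1)) then 0
  else if D.2.2 then 1 else -1

/-- `n` times the stone winding number of the orbit of `D` under `Θ_G`. -/
noncomputable def stoneWindSum {V : Type*} [Fintype V] (G : SimpleGraph V) (D : Xi V) : ℤ :=
  ∑ k ∈ Finset.range (Function.minimalPeriod (theta G) D), stoneDisp G ((theta G)^[k] D)

/-- An ensnaring graph is revolutionary if some orbit of `Θ_G` has nonzero stone winding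
number. -/
def Revolutionary {V : Type*} [Fintype V] (G : SimpleGraph V) : Prop :=
  Ensnaring G ∧ ∃ D : Xi V, stoneWindSum G D ≠ 0

section helpers

def epsI (e : Bool) : ℤ := if e then 1 else -1

theorem epsI_cast (n : ℕ) (e : Bool) : ((epsI e : ℤ) : ZMod n) = epsZ n e := by
  cases e <;> simp [epsI, epsZ]

theorem epsZ_not (n : ℕ) (e : Bool) : epsZ n (!e) = - epsZ n e := by
  cases e <;> simp [epsZ]

theorem epsZ_sq (n : ℕ) (e : Bool) : epsZ n e * epsZ n e = 1 := by
  cases e <;> simp [epsZ]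

theorem sum_period {X : Type*} (f : X → X) (g : X → ℤ) (x : X) (P : ℕ) (h : f^[P] x = x) (N : ℕ) :
    ∑ k ∈ Finset.range (N * P), g (f^[k] x) = N * ∑ k ∈ Finset.range P, g (f^[k] x) := by
  induction N with
  | zero => simp
  | succ N ih =>
    have h2 : ∀ N : ℕ, f^[N * P] x = x := by
      intro N
      induction N with
      | zero => simp
      | succ N ih => rw [Nat.succ_mul, Function.iterate_add_apply, h, ih]
    rw [Nat.succ_mul, Finset.sum_range_add, ih]
    have : ∀ k, f^[N * P + k] x = f^[k] x := by
      intro k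
      rw [Nat.add_comm, Function.iterate_add_apply, h2]
    simp only [this]
    push_cast; ring

/-- If two periods, vanishing of one sum is equivalent to vanishing of the other. -/
theorem sum_period_zero {X : Type*} (f : X → X) (g : X → ℤ) (x : X) (P Q : ℕ) (hP : f^[P] x = x)
    (hQ : f^[Q] x = x) (hP0 : 0 < P) (h : ∑ k ∈ Finset.range P, g (f^[k] x) = 0) :
    ∑ k ∈ Finset.range Q, g (f^[k] x) = 0 := by
  have h1 := sum_period f g x P hP Q
  have h2 := sum_period f g x Q hQ P
  rw [h, Nat.mul_comm, h2] at h1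
  simp at h1
  rcases h1 with h1 | h1
  · omega
  · exact h1

theorem wrap_step {n : ℕ} [NeZero n] (hn : 2 ≤ n) (z z' : ZMod n) (δ κ : ℤ) (hz : z ≠ 0) (hz' : z' ≠ 0)
    (h : z' = z + (δ : ZMod n))
    (hc : (κ = 0 ∧ (δ = 0 ∨ δ = 1 ∨ δ = -1)) ∨ (δ = 2 * κ ∧ z = -(κ : ZMod n) ∧ (κ = 1 ∨ κ = -1))) :
    (z'.val : ℤ) - z.val = δ - n * κ := by
  have hzv : 0 < z.val := by
    rcases Nat.eq_zero_or_pos z.val with h | h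
    · exact absurd ((ZMod.val_eq_zero z).1 h) hz
    · exact h
  have hzv' : 0 < z'.val := by
    rcases Nat.eq_zero_or_pos z'.val with h | h
    · exact absurd ((ZMod.val_eq_zero z').1 h) hz'
    · exact h
  have hl := ZMod.val_lt z
  have hl' := ZMod.val_lt z'
  have key : ∀ w w' : ZMod n, 0 < w.val → 0 < w'.val → ∀ t : ℤ, w' = w + (t : ZMod n) →
      (n : ℤ) ∣ (w'.val : ℤ) - w.val - t := by
    intro w w' _ _ t ht
    rw [← ZMod.intCast_zmod_eq_zero_iff_dvd]
    push_cast
    rw [ZMod.natCast_zmod_val, ZMod.natCast_zmod_val, ht]; ring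
  rcases hc with ⟨rfl, hδ⟩ | ⟨hδ, hk, hκ⟩
  · obtain ⟨q, hq⟩ := key z z' hzv hzv' δ h
    have hq0 : q = 0 := by
      by_contra hne
      have : (n : ℤ) ≤ |(n : ℤ) * q| := by
        rw [abs_mul]
        have := Int.one_le_abs hne
        have hn0 : (0 : ℤ) ≤ n := by positivity
        rw [abs_of_nonneg hn0]
        nlinarith
      rw [← hq] at this
      have h3 : |(z'.val : ℤ) - z.val - δ| < n := by
        rw [abs_lt]
        omega
      omega
    rw [hq0] at hq
    omega
  · have e1 : ∀ w : ZMod n, 0 < w.val → w = 1 → (w.val : ℤ) = 1 := by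
      intro w hw h
      obtain ⟨m, rfl⟩ : ∃ m, n = m + 2 := ⟨n - 2, by omega⟩
      have : Fact (1 < m + 2) := ⟨by omega⟩
      rw [h, ZMod.val_one]; simp
    have e2 : ∀ w : ZMod n, 0 < w.val → w = -1 → (w.val : ℤ) = n - 1 := by
      intro w hw h
      obtain ⟨m, rfl⟩ : ∃ m, n = m + 2 := ⟨n - 2, by omega⟩
      rw [h]
      have := ZMod.val_neg_one (m + 1)
      rw [this]; push_cast; ring
    rcases hκ with rfl | rfl
    · have a1 := e1 z' hzv' (by rw [h, hk, hδ]; push_cast; ring)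
      have a2 := e2 z hzv (by rw [hk]; push_cast; ring)
      rw [a1, a2, hδ]; ring
    · have a1 := e2 z' hzv' (by rw [h, hk, hδ]; push_cast; ring)
      have a2 := e1 z hzv (by rw [hk]; push_cast; ring)
      rw [a1, a2, hδ]; ring

end helpers

section coords

variable {V : Type*} [Fintype V]

def stn (D : Xi V) : ZMod (Fintype.card V) := if D.2.2 then D.2.1 else D.2.1 + 1

def car (D : Xi V) : V := D.1.symm (stn D)

def tgt (D : Xi V) : V := D.1.symm (stn D + epsZ _ D.2.2)

theorem adj_iff (G : SimpleGraph V) (D : Xi V) :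
    G.Adj (D.1.symm D.2.1) (D.1.symm (D.2.1 + 1)) ↔ G.Adj (car D) (tgt D) := by
  obtain ⟨v, i, e⟩ := D
  cases e
  · simp [car, tgt, stn, epsZ, SimpleGraph.adj_comm]
  · simp [car, tgt, stn, epsZ]

theorem theta_fst (G : SimpleGraph V) (D : Xi V) :
    (theta G D).1 = D.1.trans (Equiv.swap (stn D) (stn D + epsZ _ D.2.2)) := by
  obtain ⟨v, i, e⟩ := D
  unfold theta
  cases e
  · split_ifs <;> simp [stn, epsZ, Equiv.swap_comm]
  · split_ifs <;> simp [stn, epsZ]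

theorem theta_e (G : SimpleGraph V) (D : Xi V) :
    (theta G D).2.2 = if G.Adj (car D) (tgt D) then !D.2.2 else D.2.2 := by
  unfold theta
  simp only [adj_iff]
  split_ifs <;> rfl

theorem theta_stn (G : SimpleGraph V) (D : Xi V) :
    stn (theta G D) = if G.Adj (car D) (tgt D) then stn D else stn D + epsZ _ D.2.2 := by
  unfold theta
  simp only [adj_iff]
  obtain ⟨v, i, e⟩ := D
  split_ifs <;> cases e <;> simp [stn, epsZ]

theorem stoneDisp_eq (G : SimpleGraph V) (D : Xi V) :
    stoneDisp G D = if G.Adj (car D) (tgt D) then 0 else epsI D.2.2 := by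
  unfold stoneDisp
  simp only [adj_iff, epsI]

theorem stn_cast (G : SimpleGraph V) (D : Xi V) :
    stn (theta G D) = stn D + (stoneDisp G D : ZMod (Fintype.card V)) := by
  rw [theta_stn, stoneDisp_eq]
  split_ifs
  · simp
  · rw [epsI_cast]

theorem apply_car (D : Xi V) : D.1 (car D) = stn D := by simp [car]
theorem apply_tgt (D : Xi V) : D.1 (tgt D) = stn D + epsZ _ D.2.2 := by simp [tgt]

theorem theta_car (G : SimpleGraph V) (D : Xi V) :
    car (theta G D) = if G.Adj (car D) (tgt D) then tgt D else car D := by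
  rw [car, theta_fst, theta_stn]
  split_ifs
  · simp [tgt]
  · simp [car]

theorem one_ne (hn : 2 ≤ Fintype.card V) : (1 : ZMod (Fintype.card V)) ≠ 0 := by
  have : Fact (1 < Fintype.card V) := ⟨hn⟩
  exact one_ne_zero

theorem eps_ne (hn : 2 ≤ Fintype.card V) (e : Bool) : epsZ (Fintype.card V) e ≠ 0 := by
  cases e <;> simp [epsZ, one_ne hn]

theorem car_ne_tgt (hn : 2 ≤ Fintype.card V) (D : Xi V) : car D ≠ tgt D := by
  intro h
  have := congrArg D.1 h
  rw [apply_car, apply_tgt] at this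
  exact eps_ne hn D.2.2 (by simpa using this)

theorem disp_eq (hn : 2 ≤ Fintype.card V) (D : Xi V) (a : V) :
    disp D a = if a = car D then epsI D.2.2 else if a = tgt D then - epsI D.2.2 else 0 := by
  have h1 := one_ne hn
  obtain ⟨v, i, e⟩ := D
  unfold disp car tgt
  simp only [Equiv.eq_symm_apply]
  cases e
  · simp only [stn, epsI, epsZ]
    by_cases h : v a = i
    · simp [h, h1]
    · simp [h]
  · simp only [stn, epsI, epsZ]
    simp

theorem apply_theta (hn : 2 ≤ Fintype.card V) (G : SimpleGraph V) (D : Xi V) (a : V) :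
    (theta G D).1 a = D.1 a + (disp D a : ZMod (Fintype.card V)) := by
  rw [theta_fst, disp_eq hn]
  simp only [Equiv.trans_apply]
  by_cases h : a = car D
  · subst h; simp [apply_car, epsI_cast]
  · by_cases h' : a = tgt D
    · subst h'; simp [apply_tgt, epsI_cast, h]
    · rw [Equiv.swap_apply_of_ne_of_ne]
      · simp [h, h']
      · rwa [← apply_car D, Ne, D.1.apply_eq_iff_eq]
      · rwa [← apply_tgt D, Ne, D.1.apply_eq_iff_eq]

theorem theta_inj (G : SimpleGraph V) : Function.Injective (theta G) := by
  rintro ⟨v, i, e⟩ ⟨v', i', e'⟩ h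
  unfold theta at h
  have hv : ∀ s : Equiv.Perm (ZMod (Fintype.card V)), v.trans s = v'.trans s → v = v' := by
    intro s hs
    ext x
    have := congrArg (fun f => f x) hs
    simpa using this
  simp only at h
  split_ifs at h with h1 h2 h2
  · simp only [Prod.mk.injEq] at h
    obtain ⟨ha, hb, hc⟩ := h
    have : e = e' := by simpa using hc
    subst this
    have : i = i' := by simpa using hb
    subst this
    rw [hv _ ha]
  · exfalso
    simp only [Prod.mk.injEq] at h
    obtain ⟨ha, hb, hc⟩ := h
    subst hc
    rw [epsZ_not] at hb
    have : i = i' := by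
      have h5 := congrArg (· + epsZ (Fintype.card V) e) hb
      simpa using h5
    subst this
    rw [hv _ ha] at h1
    exact h2 h1
  · exfalso
    simp only [Prod.mk.injEq] at h
    obtain ⟨ha, hb, hc⟩ := h
    subst hc
    rw [epsZ_not] at hb
    have : i = i' := by
      have h5 := congrArg (· + epsZ (Fintype.card V) e') hb
      simpa using h5
    subst this
    rw [hv _ ha] at h1
    exact h1 h2
  · simp only [Prod.mk.injEq] at h
    obtain ⟨ha, hb, hc⟩ := h
    subst hc
    have : i = i' := by simpa using hb
    subst this
    rw [hv _ ha]

theorem period_pos [Nonempty V] (G : SimpleGraph V) (D : Xi V) :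
    0 < Function.minimalPeriod (theta G) D := by
  have : NeZero (Fintype.card V) := ⟨Fintype.card_ne_zero⟩
  have : Finite (Xi V) := by unfold Xi; infer_instance
  exact Function.minimalPeriod_pos_of_mem_periodicPts ((theta_inj G).mem_periodicPts D)

end coords

section words

variable {V : Type*} [Fintype V]

noncomputable def wordStep {V : Type*} (G : SimpleGraph V) (w : V × List V × Bool) : V × List V × Bool :=
  match w with
  | (c, [], e) => (c, [], e)
  | (c, x :: t, e) => if G.Adj c x then (x, (c :: t).reverse, !e) else (c, t ++ [x], e)

noncomputable def wordDisp {V : Type*} (w : V × List V × Bool) (a : V) : ℤ :=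
  match w with
  | (_, [], _) => 0
  | (c, x :: _, e) => if a = c then epsI e else if a = x then - epsI e else 0

noncomputable def wordStone {V : Type*} (G : SimpleGraph V) (w : V × List V × Bool) : ℤ :=
  match w with
  | (_, [], _) => 0
  | (c, x :: _, e) => if G.Adj c x then 0 else epsI e

def wtail (D : Xi V) : List V :=
  (List.range (Fintype.card V - 2)).map fun k => D.1.symm (stn D + epsZ _ D.2.2 * ((k + 2 : ℕ) : ZMod _))

def wlist (D : Xi V) : List V :=
  (List.range (Fintype.card V - 1)).map fun k => D.1.symm (stn D + epsZ _ D.2.2 * ((k + 1 : ℕ) : ZMod _))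

def word (D : Xi V) : V × List V × Bool := (car D, wlist D, D.2.2)

theorem wlist_eq (hn : 2 ≤ Fintype.card V) (D : Xi V) : wlist D = tgt D :: wtail D := by
  unfold wlist wtail tgt
  have : Fintype.card V - 1 = (Fintype.card V - 2) + 1 := by omega
  rw [this, List.range_succ_eq_map, List.map_cons, List.map_map]
  congr 1
  simp

theorem disp_word (hn : 2 ≤ Fintype.card V) (D : Xi V) (a : V) : disp D a = wordDisp (word D) a := by
  rw [disp_eq hn, word, wlist_eq hn]
  rfl

theorem stoneDisp_word (hn : 2 ≤ Fintype.card V) (G : SimpleGraph V) (D : Xi V) :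
    stoneDisp G D = wordStone G (word D) := by
  rw [stoneDisp_eq, word, wlist_eq hn]
  rfl

theorem cast_ne (k : ℕ) (h0 : 0 < k) (hk : k < Fintype.card V) : (k : ZMod (Fintype.card V)) ≠ 0 := by
  intro h
  rw [ZMod.natCast_eq_zero_iff] at h
  exact absurd (Nat.le_of_dvd h0 h) (by omega)

theorem word_theta (hn : 2 ≤ Fintype.card V) (G : SimpleGraph V) (D : Xi V) :
    word (theta G D) = wordStep G (word D) := by
  have key : ∀ k : ℕ, k < Fintype.card V - 2 → 
      (theta G D).1.symm (stn D + epsZ _ D.2.2 * ((k + 2 : ℕ) : ZMod _)) = 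
      D.1.symm (stn D + epsZ _ D.2.2 * ((k + 2 : ℕ) : ZMod _)) := by
    intro k hk
    rw [theta_fst]
    simp only [Equiv.symm_trans_apply, Equiv.symm_swap]
    congr 1
    have hu : ∀ z : ZMod (Fintype.card V), epsZ _ D.2.2 * z = 0 → z = 0 := by
      intro z hz
      have := congrArg (epsZ _ D.2.2 * ·) hz
      simpa [← mul_assoc, epsZ_sq] using this
    apply Equiv.swap_apply_of_ne_of_ne
    · intro h
      exact cast_ne (V := V) (k + 2) (by omega) (by omega) (hu _ (by simpa using h))
    · intro h
      apply cast_ne (V := V) (k + 1) (by omega) (by omega) (hu _ _)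
      have h' := congrArg (fun z => z - stn D - epsZ (Fintype.card V) D.2.2) h
      ring_nf at h'
      push_cast at h' ⊢
      linear_combination h'
  have hcs : (theta G D).1.symm (stn D) = tgt D := by
    rw [theta_fst]; simp [tgt]
  have hct : (theta G D).1.symm (stn D + epsZ _ D.2.2) = car D := by
    rw [theta_fst]; simp [car]
  have hw : word D = (car D, tgt D :: wtail D, D.2.2) := by rw [word, wlist_eq hn]
  have hcard : ((Fintype.card V : ℕ) : ZMod (Fintype.card V)) = 0 := by simp
  rw [hw]
  unfold wordStep word
  rw [theta_car, theta_e]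
  simp only
  split_ifs with h
  · congr 2
    unfold wlist wtail
    rw [theta_stn, theta_e, if_pos h, if_pos h, epsZ_not]
    apply List.ext_getElem
    · simp; omega
    · intro k h1 h2
      simp only [List.length_map, List.length_range] at h1
      rw [List.getElem_reverse]
      simp only [List.getElem_map, List.getElem_range, List.getElem_cons, List.length_cons,
        List.length_map, List.length_range]
      split_ifs with h3
      · have : k + 1 = Fintype.card V - 1 := by omega
        rw [this, Nat.cast_sub (by omega), hcard, ← hct]
        congr 1
        push_cast; ring
      · rw [← key _ (by omega)]
        congr 1
        have : Fintype.card V - 2 + 1 - 1 - k - 1 + 2 = Fintype.card V - (k + 1) := by omega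
        rw [this, Nat.cast_sub (by omega), hcard]
        ring
  · congr 2
    unfold wlist wtail
    rw [theta_stn, theta_e, if_neg h, if_neg h]
    have : Fintype.card V - 1 = (Fintype.card V - 2) + 1 := by omega
    rw [this, List.range_succ, List.map_append, List.map_singleton]
    congr 1
    · apply List.map_congr_left
      intro k hk
      rw [List.mem_range] at hk
      rw [← key k hk]
      congr 1
      push_cast; ring
    · rw [← this, ← hcs, Nat.cast_sub (by omega), hcard]
      congr 2
      push_cast; ring

theorem word_iterate (hn : 2 ≤ Fintype.card V) (G : SimpleGraph V) (D : Xi V) (k : ℕ) :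
    word ((theta G)^[k] D) = (wordStep G)^[k] (word D) := by
  induction k with
  | zero => rfl
  | succ k ih => rw [Function.iterate_succ_apply', Function.iterate_succ_apply', word_theta hn, ih]

theorem word_surj [Nonempty V] (c : V) (l : List V) (e : Bool) (hnd : (c :: l).Nodup)
    (hall : ∀ x, x ∈ c :: l) : ∃ D : Xi V, word D = (c, l, e) := by
  have : NeZero (Fintype.card V) := ⟨Fintype.card_ne_zero⟩
  have hlen : (c :: l).length = Fintype.card V := by
    rw [← List.toFinset_card_of_nodup hnd, ← Finset.card_univ]
    congr 1
    ext x
    simpa using hall x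
  let f : ZMod (Fintype.card V) → V := fun z =>
    (c :: l)[(epsZ _ e * z).val]'(by rw [hlen]; exact ZMod.val_lt _)
  have hinj : Function.Injective f := by
    intro z z' h
    have h1 := (hnd.getElem_inj_iff).1 h
    have h2 := ZMod.val_injective _ h1
    have := congrArg (epsZ _ e * ·) h2
    simpa [← mul_assoc, epsZ_sq] using this
  have hbij : Function.Bijective f := by
    rw [Fintype.bijective_iff_injective_and_card]
    exact ⟨hinj, ZMod.card _⟩
  have hs : stn (((Equiv.ofBijective f hbij).symm, (if e then 0 else -1), e) : Xi V) = 0 := by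
    cases e <;> simp [stn]
  refine ⟨((Equiv.ofBijective f hbij).symm, (if e then 0 else -1), e), ?_⟩
  unfold word car wlist
  rw [hs]
  have hl : l.length = Fintype.card V - 1 := by rw [← hlen]; simp
  simp only [Equiv.symm_symm, Equiv.ofBijective_apply]
  congr 2
  · simp [f]
  · apply List.ext_getElem
    · simp [hl]
    · intro k h1 h2
      simp only [List.getElem_map, List.getElem_range, f, zero_add, ← mul_assoc, epsZ_sq, one_mul]
      have : ((k + 1 : ℕ) : ZMod (Fintype.card V)).val = k + 1 := by
        apply ZMod.val_cast_of_lt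
        omega
      simp only [this, List.getElem_cons_succ]

theorem word_nodup (D : Xi V) : (car D :: wlist D).Nodup := by
  have h : car D :: wlist D = (List.range (Fintype.card V - 1 + 1)).map 
      fun k => D.1.symm (stn D + epsZ _ D.2.2 * ((k : ℕ) : ZMod _)) := by
    rw [List.range_succ_eq_map, List.map_cons, List.map_map]
    simp [car, wlist]
  rw [h]
  have hn : 0 < Fintype.card V := Fintype.card_pos_iff.2 ⟨car D⟩
  have : NeZero (Fintype.card V) := ⟨hn.ne'⟩
  apply List.Nodup.map_on _ List.nodup_range
  intro x hx y hy hxy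
  rw [List.mem_range] at hx hy
  have h1 : epsZ (Fintype.card V) D.2.2 * (x : ZMod (Fintype.card V)) = epsZ (Fintype.card V) D.2.2 * (y : ZMod (Fintype.card V)) := by simpa using hxy
  have h2 := congrArg (epsZ _ D.2.2 * ·) h1
  simp only [← mul_assoc, epsZ_sq, one_mul] at h2
  have h3 := congrArg ZMod.val h2
  rwa [ZMod.val_cast_of_lt (by omega), ZMod.val_cast_of_lt (by omega)] at h3

theorem word_mem (D : Xi V) (x : V) : x ∈ car D :: wlist D := by
  have hn : 0 < Fintype.card V := Fintype.card_pos_iff.2 ⟨x⟩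
  have h := word_nodup D
  have hc : (car D :: wlist D).toFinset = Finset.univ := by
    apply Finset.eq_univ_of_card
    rw [List.toFinset_card_of_nodup h]
    simp [wlist]; omega
  have := Finset.mem_univ x
  rw [← hc] at this
  simpa using this

end words

section counting

variable {V : Type*} [Fintype V]

theorem car_mem (G : SimpleGraph V) (X : Set V) (hX : ∀ x y, G.Adj x y → x ∈ X → y ∈ X) (D : Xi V)
    (h : car D ∈ X) (k : ℕ) : car ((theta G)^[k] D) ∈ X := by
  induction k with
  | zero => exact h
  | succ k ih =>
    rw [Function.iterate_succ_apply', theta_car]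
    split_ifs with h1
    · exact hX _ _ h1 ih
    · exact ih

theorem epsI_cases (e : Bool) : epsI e = 1 ∨ epsI e = -1 := by cases e <;> simp [epsI]

theorem step1 (hn : 2 ≤ Fintype.card V) (G : SimpleGraph V) (X : Set V)
    (hX : ∀ x y, G.Adj x y → x ∈ X → y ∈ X) (D : Xi V) (h : car D ∈ X) (c : V) (hc : c ∉ X) :
    ((stn (theta G D) - (theta G D).1 c).val : ℤ) - (stn D - D.1 c).val =
      stoneDisp G D + ((Fintype.card V : ℤ) - 1) * disp D c := by
  have : NeZero (Fintype.card V) := ⟨by omega⟩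
  have hcar' := car_mem G X hX D h 1
  simp only [Function.iterate_one] at hcar'
  have hne : ∀ E : Xi V, car E ∈ X → stn E - E.1 c ≠ 0 := by
    intro E hE h0
    rw [sub_eq_zero, ← apply_car, E.1.apply_eq_iff_eq] at h0
    exact hc (h0 ▸ hE)
  have hcc : c ≠ car D := fun h' => hc (h' ▸ h)
  have := wrap_step hn (stn D - D.1 c) (stn (theta G D) - (theta G D).1 c) 
    (stoneDisp G D - disp D c) (- disp D c) (hne _ h) (hne _ hcar') 
    (by rw [stn_cast, apply_theta hn]; push_cast; ring) ?_
  · rw [this]; ring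
  · rw [stoneDisp_eq, disp_eq hn, if_neg hcc]
    by_cases ht : c = tgt D
    · have hna : ¬ G.Adj (car D) (tgt D) := fun ha => hc (ht ▸ hX _ _ ha h)
      right
      rw [if_neg hna, if_pos ht, ht, apply_tgt]
      refine ⟨by ring, ?_, ?_⟩
      · push_cast
        rw [epsI_cast]; ring
      · rcases epsI_cases D.2.2 with h | h <;> rw [h] <;> simp
    · left
      rw [if_neg ht]
      refine ⟨by simp, ?_⟩
      rcases epsI_cases D.2.2 with h | h <;> rw [h] <;> split_ifs <;> simp

noncomputable def crs (D : Xi V) (x c : V) : ℤ :=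
  if x = car D ∧ c = tgt D then epsI D.2.2 else if c = car D ∧ x = tgt D then - epsI D.2.2 else 0

theorem step3 (hn : 2 ≤ Fintype.card V) (G : SimpleGraph V) (D : Xi V) (x c : V) (hxc : x ≠ c) :
    (((theta G D).1 x - (theta G D).1 c).val : ℤ) - (D.1 x - D.1 c).val =
      disp D x - disp D c - (Fintype.card V : ℤ) * crs D x c := by
  have : NeZero (Fintype.card V) := ⟨by omega⟩
  have hne : ∀ E : Xi V, E.1 x - E.1 c ≠ 0 := by
    intro E h0
    rw [sub_eq_zero, E.1.apply_eq_iff_eq] at h0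
    exact hxc h0
  have hct := car_ne_tgt hn D
  refine wrap_step hn (D.1 x - D.1 c) _ 
    (disp D x - disp D c) (crs D x c) (hne _) (hne _) 
    (by rw [apply_theta hn, apply_theta hn]; push_cast; ring) ?_
  rw [disp_eq hn, disp_eq hn, crs]
  by_cases h1 : x = car D ∧ c = tgt D
  · right
    rw [if_pos h1]
    obtain ⟨rfl, rfl⟩ := h1
    rw [if_pos rfl, if_neg hct.symm, if_pos rfl, apply_car, apply_tgt, epsI_cast]
    exact ⟨by ring, by ring, epsI_cases _⟩
  · rw [if_neg h1]
    by_cases h2 : c = car D ∧ x = tgt D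
    · right
      rw [if_pos h2]
      obtain ⟨rfl, rfl⟩ := h2
      rw [if_pos rfl, if_neg hct.symm, if_pos rfl, apply_car, apply_tgt]
      push_cast
      rw [epsI_cast]
      refine ⟨by ring, by ring, ?_⟩
      rcases epsI_cases D.2.2 with h | h <;> rw [h] <;> simp
    · left
      rw [if_neg h2]
      refine ⟨rfl, ?_⟩
      rcases epsI_cases D.2.2 with h | h <;> rw [h] <;> split_ifs <;> simp_all

theorem telescope (G : SimpleGraph V) (D : Xi V) (N : ℕ) (φ : Xi V → ℤ) (g : Xi V → ℤ) 
    (hs : ∀ k, φ ((theta G)^[k + 1] D) - φ ((theta G)^[k] D) = g ((theta G)^[k] D)) 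
    (hN : (theta G)^[N] D = D) :
    ∑ k ∈ Finset.range N, g ((theta G)^[k] D) = 0 := by
  simp only [← hs]
  rw [Finset.sum_range_sub (fun k => φ ((theta G)^[k] D)), hN]
  simp

theorem count1 (hn : 2 ≤ Fintype.card V) (G : SimpleGraph V) (X : Set V)
    (hX : ∀ x y, G.Adj x y → x ∈ X → y ∈ X) (D : Xi V) (h : car D ∈ X) (N : ℕ)
    (hN : (theta G)^[N] D = D) (c : V) (hc : c ∉ X) :
    ∑ k ∈ Finset.range N, stoneDisp G ((theta G)^[k] D) + 
      ((Fintype.card V : ℤ) - 1) * ∑ k ∈ Finset.range N, disp ((theta G)^[k] D) c = 0 := by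
  rw [Finset.mul_sum, ← Finset.sum_add_distrib]
  refine telescope G D N (fun E => ((stn E - E.1 c).val : ℤ)) 
    (fun E => stoneDisp G E + ((Fintype.card V : ℤ) - 1) * disp E c) ?_ hN
  intro k
  simp only [Function.iterate_succ_apply']
  exact step1 hn G X hX _ (car_mem G X hX D h k) c hc

theorem count3a (hn : 2 ≤ Fintype.card V) (G : SimpleGraph V) (D : Xi V) (N : ℕ)
    (hN : (theta G)^[N] D = D) (x c : V) (hxc : x ≠ c) :
    (Fintype.card V : ℤ) * ∑ k ∈ Finset.range N, crs ((theta G)^[k] D) x c = 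
     ∑ k ∈ Finset.range N, disp ((theta G)^[k] D) x - ∑ k ∈ Finset.range N, disp ((theta G)^[k] D) c := by
  have := telescope G D N (fun E => ((E.1 x - E.1 c).val : ℤ)) 
    (fun E => disp E x - disp E c - (Fintype.card V : ℤ) * crs E x c) 
    (by
      intro k
      simp only [Function.iterate_succ_apply']
      exact step3 hn G _ x c hxc) hN
  rw [Finset.sum_sub_distrib, Finset.sum_sub_distrib, ← Finset.mul_sum] at this
  linarith

theorem step2 (hn : 2 ≤ Fintype.card V) (G : SimpleGraph V) (X : Set V)
    (hX : ∀ x y, G.Adj x y → x ∈ X → y ∈ X) (D : Xi V) (h : car D ∈ X) :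
    (if tgt D ∈ X then stoneDisp G D else 0) = stoneDisp G D + 
      ∑ c ∈ Finset.univ.filter (fun c => c ∉ X), disp D c := by
  have hcar : ∀ c ∈ Finset.univ.filter (fun c => c ∉ X), 
      disp D c = if c = tgt D then - epsI D.2.2 else 0 := by
    intro c hc
    rw [Finset.mem_filter] at hc
    rw [disp_eq hn, if_neg]
    rintro rfl
    exact hc.2 h
  rw [Finset.sum_congr rfl hcar, Finset.sum_ite_eq']
  by_cases ht : tgt D ∈ X
  · simp [ht]
  · have hna : ¬ G.Adj (car D) (tgt D) := fun ha => ht (hX _ _ ha h)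
    simp [ht, stoneDisp_eq, hna]

theorem step3b (hn : 2 ≤ Fintype.card V) (X : Set V) (D : Xi V) (h : car D ∈ X) (x : V) (hx : x ∈ X) :
    disp D x - (if tgt D ∈ X then disp D x else 0) = 
      ∑ c ∈ Finset.univ.filter (fun c => c ∉ X), crs D x c := by
  have hcar : ∀ c ∈ Finset.univ.filter (fun c => c ∉ X), 
      crs D x c = if c = tgt D then (if x = car D then epsI D.2.2 else 0) else 0 := by
    intro c hc
    rw [Finset.mem_filter] at hc
    have : c ≠ car D := by
      rintro rfl
      exact hc.2 h
    rw [crs]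
    by_cases h1 : x = car D <;> by_cases h2 : c = tgt D <;> simp [h1, h2, this]
    intro h3
    exact absurd h3.symm (car_ne_tgt hn D)
  rw [Finset.sum_congr rfl hcar, Finset.sum_ite_eq']
  by_cases ht : tgt D ∈ X
  · simp [ht]
  · have : x ≠ tgt D := by
      rintro rfl
      exact ht hx
    simp [ht, disp_eq hn, this]

theorem count2 (hn : 2 ≤ Fintype.card V) (G : SimpleGraph V) (X : Set V)
    (hX : ∀ x y, G.Adj x y → x ∈ X → y ∈ X) (D : Xi V) (h : car D ∈ X) (N : ℕ) :
    ∑ k ∈ Finset.range N, (if tgt ((theta G)^[k] D) ∈ X then stoneDisp G ((theta G)^[k] D) else 0) = 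
    ∑ k ∈ Finset.range N, stoneDisp G ((theta G)^[k] D) + 
    ∑ c ∈ Finset.univ.filter (fun c => c ∉ X), ∑ k ∈ Finset.range N, disp ((theta G)^[k] D) c := by
  rw [Finset.sum_comm, ← Finset.sum_add_distrib]
  apply Finset.sum_congr rfl
  intro k _
  exact step2 hn G X hX _ (car_mem G X hX D h k)

theorem count3 (hn : 2 ≤ Fintype.card V) (G : SimpleGraph V) (X : Set V)
    (hX : ∀ x y, G.Adj x y → x ∈ X → y ∈ X) (D : Xi V) (h : car D ∈ X) (N : ℕ)
    (hN : (theta G)^[N] D = D) (x : V) (hx : x ∈ X) :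
    (Fintype.card V : ℤ) * (∑ k ∈ Finset.range N, disp ((theta G)^[k] D) x - 
      ∑ k ∈ Finset.range N, (if tgt ((theta G)^[k] D) ∈ X then disp ((theta G)^[k] D) x else 0)) = 
    ∑ c ∈ Finset.univ.filter (fun c => c ∉ X), 
      (∑ k ∈ Finset.range N, disp ((theta G)^[k] D) x - ∑ k ∈ Finset.range N, disp ((theta G)^[k] D) c) := by
  rw [← Finset.sum_sub_distrib]
  rw [Finset.sum_congr rfl (fun k _ => step3b hn X _ (car_mem G X hX D h k) x hx)]
  rw [Finset.sum_comm, Finset.mul_sum]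
  apply Finset.sum_congr rfl
  intro c hc
  rw [Finset.mem_filter] at hc
  apply count3a hn G D N hN
  rintro rfl
  exact hc.2 hx

end counting

section simulation

variable {V U : Type*}

def rng (j : U → V) : Set V := Set.range j

theorem mem_rng (j : U → V) (a : U) : j a ∈ rng j := ⟨a, rfl⟩

def WRel (j : U → V) (w : V × List V × Bool) (w' : U × List U × Bool) : Prop :=
  w.1 = j w'.1 ∧ w.2.1.filter (fun x => decide (x ∈ rng j)) = w'.2.1.map j ∧ w.2.2 = w'.2.2

theorem stepA (G : SimpleGraph V) (j : U → V)
    (hX : ∀ x y, G.Adj x y → x ∈ rng j → y ∈ rng j) (c x : V) (t : List V) (e : Bool)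
    (w' : U × List U × Bool) (hr : WRel j (c, x :: t, e) w') (hx : x ∉ rng j) :
    WRel j (wordStep G (c, x :: t, e)) w' := by
  obtain ⟨h1, h2, h3⟩ := hr
  simp only at h1 h2 h3
  have hna : ¬ G.Adj c x := fun ha => hx (hX _ _ ha ⟨_, h1.symm⟩)
  rw [List.filter_cons_of_neg (by simpa using hx)] at h2
  unfold wordStep
  simp only [if_neg hna]
  refine ⟨h1, ?_, h3⟩
  simp only
  rw [List.filter_append, List.filter_cons_of_neg (by simpa using hx), h2]
  simp

theorem stepB (G : SimpleGraph V) (H : SimpleGraph U) (j : U → V) (hj : Function.Injective j)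
    (hadj : ∀ a b, G.Adj (j a) (j b) ↔ H.Adj a b) (c x : V) (t : List V) (e : Bool)
    (w' : U × List U × Bool) (hr : WRel j (c, x :: t, e) w') (hx : x ∈ rng j) :
    WRel j (wordStep G (c, x :: t, e)) (wordStep H w') ∧ 
    (∀ a, wordDisp (c, x :: t, e) (j a) = wordDisp w' a) ∧
    wordStone G (c, x :: t, e) = wordStone H w' := by
  obtain ⟨h1, h2, h3⟩ := hr
  obtain ⟨c', l', e'⟩ := w'
  simp only at h1 h2 h3
  subst h1 h3
  rw [List.filter_cons_of_pos (by simpa using hx)] at h2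
  cases l' with
  | nil => simp at h2
  | cons y t' =>
    rw [List.map_cons, List.cons.injEq] at h2
    obtain ⟨rfl, h2⟩ := h2
    have hm : ∀ a : U, decide (j a ∈ rng j) = true := by simp [mem_rng]
    refine ⟨?_, ?_, ?_⟩
    · unfold wordStep
      simp only [hadj]
      split_ifs
      · refine ⟨rfl, ?_, rfl⟩
        simp only
        rw [List.filter_reverse, List.filter_cons_of_pos (by exact hm c'), h2, List.map_reverse, List.map_cons]
      · refine ⟨rfl, ?_, rfl⟩
        simp only
        rw [List.filter_append, List.filter_cons_of_pos (by exact hm y), h2, List.map_append]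
        simp
    · intro a
      simp only [wordDisp, hj.eq_iff]
    · simp only [wordStone, hadj]

theorem sim [Fintype V] (hn : 2 ≤ Fintype.card V) (G : SimpleGraph V) (H : SimpleGraph U) 
    (j : U → V) (hj : Function.Injective j)
    (hadj : ∀ a b, G.Adj (j a) (j b) ↔ H.Adj a b)
    (hX : ∀ x y, G.Adj x y → x ∈ rng j → y ∈ rng j)
    (D : Xi V) (w' : U × List U × Bool) (hr : WRel j (word D) w') (N : ℕ) :
    ∃ M, WRel j (word ((theta G)^[N] D)) ((wordStep H)^[M] w') ∧
      (∀ a, ∑ k ∈ Finset.range N, (if tgt ((theta G)^[k] D) ∈ rng j then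
        disp ((theta G)^[k] D) (j a) else 0) =
        ∑ k ∈ Finset.range M, wordDisp ((wordStep H)^[k] w') a) ∧
      (∑ k ∈ Finset.range N, (if tgt ((theta G)^[k] D) ∈ rng j then
        stoneDisp G ((theta G)^[k] D) else 0) =
        ∑ k ∈ Finset.range M, wordStone H ((wordStep H)^[k] w')) ∧ 
      (M = 0 → ∀ k < N, tgt ((theta G)^[k] D) ∉ rng j) := by
  induction N with
  | zero => exact ⟨0, hr, by simp, by simp, by simp⟩
  | succ N ih =>
    obtain ⟨M, i1, i2, i3, i4⟩ := ih
    have hw : ∀ E : Xi V, word E = (car E, tgt E :: wtail E, E.2.2) := by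
      intro E; rw [word, wlist_eq hn]
    by_cases ht : tgt ((theta G)^[N] D) ∈ rng j
    · refine ⟨M + 1, ?_⟩
      rw [hw] at i1
      obtain ⟨b1, b2, b3⟩ := stepB G H j hj hadj _ _ _ _ _ i1 ht
      rw [← hw] at b1 b3
      simp only [Finset.sum_range_succ, Function.iterate_succ_apply', word_theta hn]
      refine ⟨b1, ?_, ?_, by omega⟩
      · intro a
        have := b2 a
        rw [← hw] at this
        rw [i2 a, if_pos ht, disp_word hn, this]
      · rw [i3, if_pos ht, stoneDisp_word hn, b3]
    · refine ⟨M, ?_⟩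
      rw [hw] at i1
      have b1 := stepA G j hX _ _ _ _ _ i1 ht
      rw [← hw] at b1
      simp only [Finset.sum_range_succ, Function.iterate_succ_apply' _ N, word_theta hn]
      refine ⟨b1, ?_, ?_, ?_⟩
      · intro a
        rw [i2 a, if_neg ht, add_zero]
      · rw [i3, if_neg ht, add_zero]
      · intro h0 k hk
        rcases Nat.lt_succ_iff_lt_or_eq.1 hk with hk | rfl
        · exact i4 h0 k hk
        · exact ht

end simulation

section core

variable {V U : Type*}

theorem WRel.unique (j : U → V) (hj : Function.Injective j) {w : V × List V × Bool}
    {w1 w2 : U × List U × Bool} (h1 : WRel j w w1) (h2 : WRel j w w2) : w1 = w2 := by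
  obtain ⟨a1, a2, a3⟩ := h1
  obtain ⟨b1, b2, b3⟩ := h2
  refine Prod.ext (hj (a1.symm.trans b1)) (Prod.ext ?_ (a3.symm.trans b3))
  exact (List.map_injective_iff.2 hj) (a2.symm.trans b2)

theorem exists_up [Fintype V] [Fintype U] (j : U → V) (hj : Function.Injective j) (D' : Xi U) :
    ∃ D : Xi V, WRel j (word D) (word D') := by
  have : Nonempty V := ⟨j (car D')⟩
  have hnd := word_nodup D'
  have hmem := word_mem D'
  let rest := (Finset.univ.filter (fun x : V => x ∉ rng j)).toList
  have hrest : ∀ x, x ∈ rest ↔ x ∉ rng j := by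
    intro x; simp only [rest, Finset.mem_toList, Finset.mem_filter, Finset.mem_univ, true_and]
  obtain ⟨D, hD⟩ := word_surj (j (car D')) ((wlist D').map j ++ rest) D'.2.2 (by
      rw [← List.cons_append, ← List.map_cons, List.nodup_append]
      refine ⟨hnd.map hj, Finset.nodup_toList _, ?_⟩
      intro a ha b hb hab
      rw [List.mem_map] at ha
      obtain ⟨u, _, rfl⟩ := ha
      exact (hrest b).1 hb ⟨u, hab⟩) (by
      intro x
      rw [← List.cons_append, ← List.map_cons, List.mem_append]
      by_cases hx : x ∈ rng j
      · left
        obtain ⟨u, rfl⟩ := hx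
        exact List.mem_map_of_mem (hmem u)
      · right
        exact (hrest x).2 hx)
  refine ⟨D, ?_⟩
  rw [hD]
  refine ⟨rfl, ?_, rfl⟩
  simp only [word]
  rw [List.filter_append, List.filter_eq_self.2, List.filter_eq_nil_iff.2, List.append_nil]
  · intro x hx
    simpa using (hrest x).1 hx
  · intro x hx
    rw [List.mem_map] at hx
    obtain ⟨u, _, rfl⟩ := hx
    simp [mem_rng]

theorem exists_down [Fintype V] [Fintype U] (j : U → V) (hj : Function.Injective j) (D : Xi V)
    (h : car D ∈ rng j) : ∃ D' : Xi U, WRel j (word D) (word D') := by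
  obtain ⟨c, hc⟩ := h
  have : Nonempty U := ⟨c⟩
  have hnd := word_nodup D
  have hmem := word_mem D
  have hl : ∃ l' : List U, l'.map j = (wlist D).filter (fun x => decide (x ∈ rng j)) := by
    have : (wlist D).filter (fun x => decide (x ∈ rng j)) ∈ Set.range (List.map j) := by
      rw [Set.range_list_map]
      intro x hx
      have h5 : x ∈ rng j := by simpa using (List.mem_filter.1 hx).2
      exact h5
    exact this
  obtain ⟨l', hl'⟩ := hl
  rw [← hc] at hnd hmem
  obtain ⟨D', hD'⟩ := word_surj c l' D.2.2 (by
      apply List.Nodup.of_map j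
      rw [List.map_cons, hl']
      rw [List.nodup_cons] at hnd ⊢
      exact ⟨fun h => hnd.1 (List.mem_filter.1 h).1, hnd.2.filter _⟩) (by
      intro u
      have h1 : j u ∈ (c :: l').map j := by
        rw [List.map_cons, hl']
        have := hmem (j u)
        rw [List.mem_cons] at this ⊢
        rcases this with h | h
        · exact Or.inl h
        · right
          rw [List.mem_filter]
          exact ⟨h, by simp [mem_rng]⟩
      exact (List.mem_map_of_injective hj).1 h1)
  refine ⟨D', ?_⟩
  rw [hD']
  exact ⟨hc.symm, hl'.symm, rfl⟩

theorem windSum_word [Fintype U] (hn : 2 ≤ Fintype.card U) (H : SimpleGraph U) (D : Xi U) (a : U) :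
    windSum H D a = ∑ k ∈ Finset.range (Function.minimalPeriod (theta H) D),
      wordDisp ((wordStep H)^[k] (word D)) a := by
  unfold windSum
  simp only [← word_iterate hn, disp_word hn]

theorem stoneWindSum_word [Fintype U] (hn : 2 ≤ Fintype.card U) (H : SimpleGraph U) (D : Xi U) :
    stoneWindSum H D = ∑ k ∈ Finset.range (Function.minimalPeriod (theta H) D),
      wordStone H ((wordStep H)^[k] (word D)) := by
  unfold stoneWindSum
  simp only [← word_iterate hn, stoneDisp_word hn]

theorem stone_no_edge [Fintype V] (G : SimpleGraph V) (D : Xi V) (N : ℕ)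
    (h : ∀ k < N, ¬ G.Adj (car ((theta G)^[k] D)) (tgt ((theta G)^[k] D))) :
    ((theta G)^[N] D).2.2 = D.2.2 ∧
      ∑ k ∈ Finset.range N, stoneDisp G ((theta G)^[k] D) = N * epsI D.2.2 := by
  induction N with
  | zero => simp
  | succ N ih =>
    obtain ⟨h1, h2⟩ := ih (fun k hk => h k (by omega))
    have h3 := h N (by omega)
    rw [Finset.sum_range_succ, h2, Function.iterate_succ_apply', theta_e, if_neg h3, stoneDisp_eq,
      if_neg h3, h1]
    refine ⟨rfl, ?_⟩
    push_cast; ring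

theorem core [Fintype V] [Fintype U] [Nonempty U] (hn : 2 ≤ Fintype.card V) (G : SimpleGraph V)
    (H : SimpleGraph U) (j : U → V) (hj : Function.Injective j)
    (hadj : ∀ a b, G.Adj (j a) (j b) ↔ H.Adj a b)
    (hX : ∀ x y, G.Adj x y → x ∈ rng j → y ∈ rng j)
    (hout : ∃ x, x ∉ rng j) :
    (∀ D : Xi V, car D ∈ rng j → WindingVectorZero G D) ↔
      (Ensnaring H ∧ ¬ Revolutionary H) := by
  obtain ⟨x0, hx0⟩ := hout
  have : Nonempty V := ⟨x0⟩
  constructor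
  · intro hG
    have main : ∀ D' : Xi U, (∀ a, windSum H D' a = 0) ∧ stoneWindSum H D' = 0 := by
      intro D'
      obtain ⟨D, hD⟩ := exists_up j hj D'
      have hcar : car D ∈ rng j := ⟨_, hD.1.symm⟩
      have hz := hG D hcar
      have hN0 := period_pos G D
      have hN : (theta G)^[Function.minimalPeriod (theta G) D] D = D :=
        Function.iterate_minimalPeriod
      unfold WindingVectorZero windSum at hz
      generalize Function.minimalPeriod (theta G) D = N at hz hN0 hN
      have hT := count1 hn G _ hX D hcar N hN x0 hx0
      rw [hz x0, mul_zero, add_zero] at hT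
      have hex : ∃ k < N, tgt ((theta G)^[k] D) ∈ rng j := by
        by_contra hcon
        push Not at hcon
        have := (stone_no_edge G D N (fun k hk ha => 
          hcon k hk (hX _ _ ha (car_mem G _ hX D hcar k)))).2
        rw [hT] at this
        rcases epsI_cases D.2.2 with h | h <;> rw [h] at this <;> omega
      obtain ⟨M, s1, s2, s3, s4⟩ := sim hn G H j hj hadj hX D _ hD N
      have hM : 0 < M := by
        rcases Nat.eq_zero_or_pos M with h | h
        · obtain ⟨k, hk, hk'⟩ := hex
          exact absurd hk' (s4 h k hk)
        · exact h
      have hU : 2 ≤ Fintype.card U := by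
        obtain ⟨k, hk, a, ha⟩ := hex
        obtain ⟨b, hb⟩ := car_mem G _ hX D hcar k
        have hab : a ≠ b := by
          rintro rfl
          exact car_ne_tgt hn _ (hb.symm.trans ha)
        exact Fintype.one_lt_card_iff.2 ⟨a, b, hab⟩
      rw [hN] at s1
      have hM' := WRel.unique j hj s1 hD
      have hP : (wordStep H)^[Function.minimalPeriod (theta H) D'] (word D') = word D' := by
        rw [← word_iterate hU, Function.iterate_minimalPeriod]
      constructor
      · intro a
        rw [windSum_word hU]
        refine sum_period_zero (wordStep H) (fun w => wordDisp w a) (word D') M _ hM' hP hM ?_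
        rw [← s2 a]
        have := count3 hn G _ hX D hcar N hN (j a) ⟨a, rfl⟩
        simp only [hz, sub_zero, zero_sub, Finset.sum_const_zero] at this
        rcases mul_eq_zero.1 this with h | h
        · omega
        · simpa using h
      · rw [stoneWindSum_word hU]
        refine sum_period_zero (wordStep H) (fun w => wordStone H w) (word D') M _ hM' hP hM ?_
        rw [← s3, count2 hn G _ hX D hcar N, hT]
        simp only [hz, Finset.sum_const_zero, add_zero]
    refine ⟨Or.inr fun D' => (main D').1, ?_⟩
    rintro ⟨_, D', h⟩
    exact h (main D').2
  · rintro ⟨hE, hR⟩ D hcar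
    have hS : ∀ D' : Xi U, stoneWindSum H D' = 0 := by
      intro D'
      by_contra h
      exact hR ⟨hE, D', h⟩
    obtain ⟨D', hD⟩ := exists_down j hj D hcar
    have hP0 := period_pos H D'
    have hU1 : Fintype.card U ≠ 1 := by
      intro h1
      have hsub : Subsingleton U := Fintype.card_le_one_iff_subsingleton.1 h1.le
      have h2 := (stone_no_edge H D' (Function.minimalPeriod (theta H) D') (fun k _ ha =>
        ha.ne (Subsingleton.elim _ _))).2
      have h3 := hS D'
      rw [stoneWindSum, h2] at h3
      rcases epsI_cases D'.2.2 with h | h <;> rw [h] at h3 <;> omega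
    have hU : 2 ≤ Fintype.card U := by
      have := Fintype.card_pos (α := U)
      omega
    have hE' : ∀ D' : Xi U, WindingVectorZero H D' := hE.resolve_left hU1
    have hN : (theta G)^[Function.minimalPeriod (theta G) D] D = D :=
      Function.iterate_minimalPeriod
    unfold WindingVectorZero windSum
    generalize Function.minimalPeriod (theta G) D = N at hN
    obtain ⟨M, s1, s2, s3, -⟩ := sim hn G H j hj hadj hX D _ hD N
    rw [hN] at s1
    have hM' := WRel.unique j hj s1 hD
    have hP : (wordStep H)^[Function.minimalPeriod (theta H) D'] (word D') = word D' := by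
      rw [← word_iterate hU, Function.iterate_minimalPeriod]
    have hT1 : ∑ k ∈ Finset.range M, wordStone H ((wordStep H)^[k] (word D')) = 0 := by
      refine sum_period_zero (wordStep H) (fun w => wordStone H w) (word D') _ M hP hM' hP0 ?_
      rw [← stoneWindSum_word hU, hS]
    have hd1 : ∀ a, ∑ k ∈ Finset.range M, wordDisp ((wordStep H)^[k] (word D')) a = 0 := by
      intro a
      refine sum_period_zero (wordStep H) (fun w => wordDisp w a) (word D') _ M hP hM' hP0 ?_
      rw [← windSum_word hU, hE']
    simp only [hd1] at s2
    rw [hT1, count2 hn G _ hX D hcar N] at s3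
    have c1 := count1 hn G _ hX D hcar N hN
    have hcards : ((Finset.univ.filter (fun c => c ∉ rng j)).card : ℤ) + Fintype.card U
        = Fintype.card V := by
      have h1 : (Finset.univ.filter (fun c => c ∈ rng j)).card = Fintype.card U := by
        rw [← Finset.card_univ, ← Finset.card_image_of_injective _ hj]
        congr 1
        ext x
        simp [rng]
      have h2 := Finset.card_filter_add_card_filter_not (s := (Finset.univ : Finset V)) 
        (fun c => c ∈ rng j)
      rw [Finset.card_univ, h1] at h2
      have h3 : (Finset.univ.filter (fun c => c ∉ rng j)).card + Fintype.card U
        = Fintype.card V := by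
        rw [← h2, add_comm]
      exact_mod_cast h3
    have hT0 : ∑ k ∈ Finset.range N, stoneDisp G ((theta G)^[k] D) = 0 := by
      have h4 := congrArg (((Fintype.card V : ℤ) - 1) * ·) s3
      simp only [mul_add, Finset.mul_sum _ _ ((Fintype.card V : ℤ) - 1), mul_zero] at h4
      have h5 : ∀ c ∈ Finset.univ.filter (fun c => c ∉ rng j), 
          ∑ k ∈ Finset.range N, ((Fintype.card V : ℤ) - 1) * disp ((theta G)^[k] D) c = 
          - ∑ k ∈ Finset.range N, stoneDisp G ((theta G)^[k] D) := by
        intro c hc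
        rw [← Finset.mul_sum]
        have := c1 c (Finset.mem_filter.1 hc).2
        linarith
      rw [Finset.sum_congr rfl h5, Finset.sum_const, ← Finset.mul_sum, nsmul_eq_mul] at h4
      have h6 : ((Fintype.card U : ℤ) - 1) * ∑ k ∈ Finset.range N, stoneDisp G ((theta G)^[k] D) = 0 := by
        rw [← h4, ← hcards]; ring
      rcases mul_eq_zero.1 h6 with h | h
      · omega
      · exact h
    have hd : ∀ c, c ∉ rng j → ∑ k ∈ Finset.range N, disp ((theta G)^[k] D) c = 0 := by
      intro c hc
      have := c1 c hc
      rw [hT0, zero_add] at this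
      rcases mul_eq_zero.1 this with h | h
      · omega
      · exact h
    intro x
    by_cases hx : x ∈ rng j
    · obtain ⟨a, rfl⟩ := hx
      have h7 := count3 hn G _ hX D hcar N hN (j a) ⟨a, rfl⟩
      rw [s2 a, sub_zero] at h7
      have h9 : ∀ c ∈ Finset.univ.filter (fun c => c ∉ rng j),
          (∑ k ∈ Finset.range N, disp ((theta G)^[k] D) (j a) -
            ∑ k ∈ Finset.range N, disp ((theta G)^[k] D) c) =
          ∑ k ∈ Finset.range N, disp ((theta G)^[k] D) (j a) := by
        intro c hc
        rw [hd c (Finset.mem_filter.1 hc).2, sub_zero]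
      rw [Finset.sum_congr rfl h9, Finset.sum_const, nsmul_eq_mul] at h7
      have h8 : (Fintype.card U : ℤ) * ∑ k ∈ Finset.range N, disp ((theta G)^[k] D) (j a) = 0 := by
        rw [← hcards] at h7
        linarith
      rcases mul_eq_zero.1 h8 with h | h
      · omega
      · exact h
    · exact hd x hx

end core

/-- The disjoint union of two graphs `G₁` and `G₂` (each with at least one
vertex, and with at least `3` vertices in total) is ensnaring if and only if both `G₁` and
`G₂` are ensnaring but not revolutionary. -/
theorem stmt_7 {V₁ V₂ : Type*} [Fintype V₁] [Fintype V₂] [Nonempty V₁] [Nonempty V₂]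
    (G₁ : SimpleGraph V₁) (G₂ : SimpleGraph V₂)
    (h3 : 3 ≤ Fintype.card V₁ + Fintype.card V₂) :
    Ensnaring (G₁ ⊕g G₂) ↔
      (Ensnaring G₁ ∧ ¬ Revolutionary G₁) ∧ (Ensnaring G₂ ∧ ¬ Revolutionary G₂) := by
  have hn : 2 ≤ Fintype.card (V₁ ⊕ V₂) := by rw [Fintype.card_sum]; omega
  have c1 := core hn (G₁ ⊕g G₂) G₁ Sum.inl Sum.inl_injective (by simp)
    (by
      rintro x y h ⟨a, rfl⟩
      cases y <;> simp_all [rng])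
    ⟨Sum.inr (Classical.arbitrary V₂), by simp [rng]⟩
  have c2 := core hn (G₁ ⊕g G₂) G₂ Sum.inr Sum.inr_injective (by simp)
    (by
      rintro x y h ⟨a, rfl⟩
      cases y <;> simp_all [rng])
    ⟨Sum.inl (Classical.arbitrary V₁), by simp [rng]⟩
  rw [← c1, ← c2]
  constructor
  · rintro (h | h)
    · omega
    · exact ⟨fun D _ => h D, fun D _ => h D⟩
  · rintro ⟨h1, h2⟩
    right
    intro D
    rcases hc : car D with a | a
    · exact h1 D (by rw [hc]; exact ⟨a, rfl⟩)
    · exact h2 D (by rw [hc]; exact ⟨a, rfl⟩)
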